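/- Let A ∈ ℝ^{ν×ν} have no purely imaginary or zero eigenvalues (i₀(A) = 0), let Q ⪰ 0 be symmetric, and let P = Pᵀ satisfy P A + Aᵀ P = −Q. Then the number of positive eigenvalues of P is at most the number of eigenvalues of A with negative real part, and the number of negative eigenvalues of P is at most the number of eigenvalues of A with positive real part. -/

import Mathlib

open Matrix

-- Number of complex eigenvalues (with algebraic multiplicity) of a real matrix
-- satisfying a given predicate.
open Classical in
noncomputable def eigCount {ν : ℕ} (M : Matrix (Fin ν) (Fin ν) ℝ)
    (pred : ℂ → Prop) : ℕ :=
  Multiset.card (Multiset.filter pred ((M.charpoly.map (algebraMap ℝ ℂ)).roots))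

open Filter Topology Module

section Flow

variable {V : Type*} [NormedAddCommGroup V] [NormedSpace ℂ V]

/-- The vectors `x` through which some solution of `y' = f y` passes that tends to `0` as time
goes to `-∞`. -/
def unstableSubspace (f : End ℂ V) : Submodule ℂ V where
  carrier := {x | ∃ y : ℝ → V, (∀ t, HasDerivAt y (f (y t)) t) ∧ y 0 = x ∧
    Tendsto y atBot (𝓝 0)}
  zero_mem' := ⟨fun _ => 0, fun t => by simpa using hasDerivAt_const t (0 : V), rfl,
    tendsto_const_nhds⟩
  add_mem' := by
    rintro _ _ ⟨y, hy, rfl, hy0⟩ ⟨z, hz, rfl, hz0⟩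
    exact ⟨fun t => y t + z t, fun t => by simpa using (hy t).fun_add (hz t), rfl,
      by simpa using hy0.add hz0⟩
  smul_mem' := by
    rintro c _ ⟨y, hy, rfl, hy0⟩
    exact ⟨fun t => c • y t, fun t => by simpa using (hy t).fun_const_smul c, rfl,
      by simpa using hy0.const_smul c⟩

theorem hasDerivAt_sum_pow_div_factorial_smul (B : End ℂ V) (x : V) (n : ℕ) (t : ℝ) :
    HasDerivAt
      (fun t : ℝ => ∑ k ∈ Finset.range (n + 1), ((t ^ k / k.factorial : ℝ) : ℂ) • (B ^ k) x)
      (B (∑ k ∈ Finset.range n, ((t ^ k / k.factorial : ℝ) : ℂ) • (B ^ k) x)) t := by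
  simp_rw [Finset.sum_range_succ']
  have h : ∀ k : ℕ, HasDerivAt
      (fun t : ℝ => ((t ^ (k + 1) / (k + 1).factorial : ℝ) : ℂ) • (B ^ (k + 1)) x)
      (((t ^ k / k.factorial : ℝ) : ℂ) • (B ^ (k + 1)) x) t := by
    intro k
    refine HasDerivAt.smul_const (HasDerivAt.ofReal_comp ?_) _
    refine ((hasDerivAt_pow (k + 1) t).div_const ((k + 1).factorial : ℝ)).congr_deriv ?_
    rw [Nat.factorial_succ]
    push_cast
    have : (k.factorial : ℝ) ≠ 0 := by positivity
    have : (k + 1 : ℝ) ≠ 0 := by positivity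
    field_simp
  have h' := (HasDerivAt.fun_sum (u := Finset.range n) fun k _ => h k).add_const
    (((t ^ 0 / Nat.factorial 0 : ℝ) : ℂ) • (B ^ 0) x)
  simpa [map_sum, pow_succ'] using h'

theorem tendsto_cexp_mul_pow_atBot {μ : ℂ} (hμ : 0 < μ.re) (k : ℕ) :
    Tendsto (fun t : ℝ => Complex.exp (t * μ) * (t : ℂ) ^ k) atBot (𝓝 0) := by
  rw [tendsto_zero_iff_norm_tendsto_zero, ← tendsto_comp_neg_atTop_iff]
  have h := (Real.tendsto_pow_mul_exp_neg_atTop_nhds_zero k).comp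
    (tendsto_id.const_mul_atTop hμ)
  have h' := h.const_mul ((μ.re ^ k)⁻¹)
  rw [mul_zero] at h'
  refine h'.congr' ?_
  filter_upwards [eventually_ge_atTop 0] with t ht
  have : μ.re ^ k ≠ 0 := by positivity
  simp [Complex.norm_exp, abs_of_nonneg ht, mul_pow]
  field_simp

theorem maxGenEigenspace_le_unstableSubspace (f : End ℂ V) {μ : ℂ} (hμ : 0 < μ.re) :
    f.maxGenEigenspace μ ≤ unstableSubspace f := by
  intro x hx
  obtain ⟨n, hn⟩ := (End.mem_maxGenEigenspace f μ x).1 hx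
  set B : End ℂ V := f - μ • (1 : End ℂ V) with hB
  set w : ℝ → V := fun t => ∑ k ∈ Finset.range (n + 1), ((t ^ k / k.factorial : ℝ) : ℂ) • (B ^ k) x
    with hw
  have hwd : ∀ t, HasDerivAt w (B (w t)) t := by
    intro t
    convert hasDerivAt_sum_pow_div_factorial_smul B x n t using 2
    rw [hw]
    simp only
    rw [Finset.sum_range_succ, hn, smul_zero, add_zero]
  refine ⟨fun t => Complex.exp (t * μ) • w t, fun t => ?_, ?_, ?_⟩
  · have he : HasDerivAt (fun t : ℝ => Complex.exp (t * μ)) (Complex.exp (t * μ) * μ) t := by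
      have := ((hasDerivAt_id t).ofReal_comp.mul_const μ).cexp
      simpa using this
    convert he.fun_smul (hwd t) using 1
    rw [hB]
    simp only [map_smul, LinearMap.sub_apply, LinearMap.smul_apply, End.one_apply]
    module
  · simp [hw, Finset.sum_range_succ']
  · simp only [hw, Finset.smul_sum, smul_smul]
    rw [← Finset.sum_const_zero (s := Finset.range (n + 1))]
    refine tendsto_finsetSum _ fun k _ => ?_
    have h := ((tendsto_cexp_mul_pow_atBot hμ k).mul_const ((k.factorial : ℂ)⁻¹)).smul_const
      ((B ^ k) x)
    simpa [div_eq_mul_inv, mul_assoc] using h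

end Flow

section Form

variable {n : Type*} [Fintype n]

theorem HasDerivAt.dotProduct {u v : ℝ → n → ℂ} {u' v' : n → ℂ} {t : ℝ}
    (hu : HasDerivAt u u' t) (hv : HasDerivAt v v' t) :
    HasDerivAt (fun s => u s ⬝ᵥ v s) (u' ⬝ᵥ v t + u t ⬝ᵥ v') t := by
  simp only [_root_.dotProduct, ← Finset.sum_add_distrib]
  exact HasDerivAt.fun_sum fun i _ => (hasDerivAt_pi.1 hu i).fun_mul (hasDerivAt_pi.1 hv i)

theorem re_dotProduct_mulVec_nonpos_of_mem_unstableSubspace [DecidableEq n] {A P Q : Matrix n n ℂ}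
    (hQ : ∀ x : n → ℂ, 0 ≤ (star x ⬝ᵥ Q *ᵥ x).re) (hLyap : P * A + Aᴴ * P = -Q) {x : n → ℂ}
    (hx : x ∈ unstableSubspace A.toLin') : (star x ⬝ᵥ P *ᵥ x).re ≤ 0 := by
  obtain ⟨y, hy, rfl, hlim⟩ := hx
  have hd : ∀ t, HasDerivAt (fun t => (star (y t) ⬝ᵥ P *ᵥ y t).re)
      (-(star (y t) ⬝ᵥ Q *ᵥ y t).re) t := by
    intro t
    have h1 : HasDerivAt (fun t => P *ᵥ y t) (P *ᵥ (A *ᵥ y t)) t :=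
      ((P.mulVecLin.restrictScalars ℝ).toContinuousLinearMap.hasFDerivAt.comp_hasDerivAt t (hy t))
    have h2 : HasDerivAt (fun t => star (y t)) (star (A *ᵥ y t)) t := (hy t).star
    have h3 := Complex.reCLM.hasFDerivAt.comp_hasDerivAt t (h2.dotProduct h1)
    refine h3.congr_deriv ?_
    rw [← Complex.neg_re, ← dotProduct_neg, ← neg_mulVec, ← hLyap, add_mulVec, dotProduct_add,
      star_mulVec, ← dotProduct_mulVec, mulVec_mulVec, mulVec_mulVec, add_comm]
    rfl
  have hanti : Antitone fun t => (star (y t) ⬝ᵥ P *ᵥ y t).re :=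
    antitone_of_hasDerivAt_nonpos hd fun t => by simpa using hQ (y t)
  have hcont : Continuous fun z : n → ℂ => (star z ⬝ᵥ P *ᵥ z).re := by fun_prop
  have hlim' : Tendsto (fun t => (star (y t) ⬝ᵥ P *ᵥ y t).re) atBot (𝓝 0) := by
    simpa [Function.comp_def] using (hcont.tendsto 0).comp hlim
  exact hanti.ge_of_tendsto hlim' 0

theorem Matrix.PosSemidef.re_dotProduct_map_ofReal_nonneg {Q : Matrix n n ℝ} (hQ : Q.PosSemidef)
    (x : n → ℂ) : 0 ≤ (star x ⬝ᵥ Q.map (algebraMap ℝ ℂ) *ᵥ x).re := by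
  have h1 := hQ.dotProduct_mulVec_nonneg fun i => (x i).re
  have h2 := hQ.dotProduct_mulVec_nonneg fun i => (x i).im
  have : (star x ⬝ᵥ Q.map (algebraMap ℝ ℂ) *ᵥ x).re =
      star (fun i => (x i).re) ⬝ᵥ Q *ᵥ (fun i => (x i).re) +
      star (fun i => (x i).im) ⬝ᵥ Q *ᵥ (fun i => (x i).im) := by
    simp [_root_.dotProduct, mulVec, ← Finset.sum_add_distrib]
  rw [this]
  exact add_nonneg h1 h2

theorem Matrix.IsHermitian.exists_posDef_subspace [DecidableEq n] {H : Matrix n n ℂ}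
    (hH : H.IsHermitian) :
    ∃ W : Submodule ℂ (n → ℂ), finrank ℂ W = Fintype.card {i // 0 < hH.eigenvalues i} ∧
      ∀ x ∈ W, x ≠ 0 → 0 < (star x ⬝ᵥ H *ᵥ x).re := by
  set U : Matrix n n ℂ := (hH.eigenvectorUnitary : Matrix n n ℂ)
  let E := Function.ExtendByZero.linearMap ℂ
    (Subtype.val : {i // 0 < hH.eigenvalues i} → n)
  have hpos : ∀ c, c ≠ 0 → 0 < (star (U *ᵥ E c) ⬝ᵥ H *ᵥ (U *ᵥ E c)).re := by
    intro c hc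
    have hdiag : Uᴴ * H * U = diagonal (RCLike.ofReal ∘ hH.eigenvalues) := by
      have := hH.conjStarAlgAut_star_eigenvectorUnitary
      rw [Unitary.conjStarAlgAut_star_apply] at this
      exact this
    have hval : (star (U *ᵥ E c) ⬝ᵥ H *ᵥ (U *ᵥ E c)).re =
        ∑ i, hH.eigenvalues i * Complex.normSq (E c i) := by
      rw [star_mulVec, ← dotProduct_mulVec, mulVec_mulVec, mulVec_mulVec, hdiag]
      simp only [_root_.dotProduct, mulVec_diagonal, Complex.re_sum]
      refine Finset.sum_congr rfl fun i _ => ?_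
      simp [Complex.normSq_apply]
      ring
    have hE : ∀ i, E c i.1 = c i := fun i => Subtype.val_injective.extend_apply _ _ _
    have hE0 : ∀ i, ¬ 0 < hH.eigenvalues i → E c i = 0 := fun i hi =>
      Function.extend_apply' _ _ _ (by rintro ⟨j, rfl⟩; exact hi j.2)
    rw [hval]
    obtain ⟨i, hi⟩ := Function.ne_iff.1 hc
    refine Finset.sum_pos' (fun j _ => ?_) ⟨i.1, Finset.mem_univ _, ?_⟩
    · by_cases hj : 0 < hH.eigenvalues j
      · exact mul_nonneg hj.le (Complex.normSq_nonneg _)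
      · simp [hE0 j hj]
    · rw [hE]
      exact mul_pos i.2 (Complex.normSq_pos.2 hi)
  let L := U.mulVecLin ∘ₗ E
  have hinj : Function.Injective L := by
    refine (injective_iff_map_eq_zero L).2 fun c hc => ?_
    by_contra h
    have h1 := hpos c h
    rw [show U *ᵥ E c = 0 from hc] at h1
    simp at h1
  refine ⟨LinearMap.range L, ?_, ?_⟩
  · rw [LinearMap.finrank_range_of_inj hinj, finrank_fintype_fun_eq_card]
  · rintro _ ⟨c, rfl⟩ hc
    exact hpos c fun h => hc (by rw [h, map_zero])

end Form

section Count

variable {ν : ℕ}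

theorem rootMultiplicity_charpoly_map (M : Matrix (Fin ν) (Fin ν) ℝ) (μ : ℂ) :
    (M.charpoly.map (algebraMap ℝ ℂ)).rootMultiplicity μ =
      finrank ℂ (End.maxGenEigenspace (M.map (algebraMap ℝ ℂ)).toLin' μ) := by
  rw [LinearMap.finrank_maxGenEigenspace_eq, charpoly_toLin', charpoly_map]

theorem maxGenEigenspace_neg {V : Type*} [AddCommGroup V] [Module ℂ V] (f : End ℂ V) (μ : ℂ) :
    (-f).maxGenEigenspace μ = f.maxGenEigenspace (-μ) := by
  ext x
  simp only [End.mem_maxGenEigenspace]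
  have : -f - μ • (1 : End ℂ V) = -(f - -μ • (1 : End ℂ V)) := by module
  simp_rw [this]
  refine exists_congr fun k => ?_
  rcases k.even_or_odd with h | h
  · rw [h.neg_pow]
  · rw [h.neg_pow, LinearMap.neg_apply, neg_eq_zero]

theorem eigCount_neg (M : Matrix (Fin ν) (Fin ν) ℝ) (p : ℂ → Prop) :
    eigCount (-M) p = eigCount M fun μ => p (-μ) := by
  classical
  have hM : (-M).map (algebraMap ℝ ℂ) = -M.map (algebraMap ℝ ℂ) := by ext; simp
  have h : ((-M).charpoly.map (algebraMap ℝ ℂ)).roots =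
      ((M.charpoly.map (algebraMap ℝ ℂ)).roots).map Neg.neg := by
    ext μ
    rw [← neg_neg μ, Multiset.count_map_eq_count' _ _ neg_injective, neg_neg,
      Polynomial.count_roots, Polynomial.count_roots, rootMultiplicity_charpoly_map,
      rootMultiplicity_charpoly_map, ← maxGenEigenspace_neg, ← map_neg, hM]
  unfold eigCount
  rw [h, Multiset.filter_map, Multiset.card_map]
  rfl

theorem finrank_finset_sup_le {K V ι : Type*} [Field K] [AddCommGroup V] [Module K V]
    [FiniteDimensional K V] (s : Finset ι) (W : ι → Submodule K V) :
    finrank K (s.sup W : Submodule K V) ≤ ∑ i ∈ s, finrank K (W i) := by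
  classical
  induction s using Finset.induction_on with
  | empty => simp
  | insert i s hi ih =>
    rw [Finset.sup_insert, Finset.sum_insert hi]
    exact (Submodule.finrank_add_le_finrank_add_finrank _ _).trans (by gcongr)

theorem exists_sup_unstableSubspace_eq_top (A : Matrix (Fin ν) (Fin ν) ℝ)
    (hA0 : eigCount A (fun μ => μ.re = 0) = 0) :
    ∃ S : Submodule ℂ (Fin ν → ℂ), finrank ℂ S ≤ eigCount A (fun μ => μ.re < 0) ∧
      unstableSubspace (A.map (algebraMap ℝ ℂ)).toLin' ⊔ S = ⊤ := by
  classical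
  set f : End ℂ (Fin ν → ℂ) := (A.map (algebraMap ℝ ℂ)).toLin'
  set R := (A.charpoly.map (algebraMap ℝ ℂ)).roots with hR
  have hcount : ∀ μ, R.count μ = finrank ℂ (f.maxGenEigenspace μ) := fun μ => by
    rw [hR, Polynomial.count_roots, rootMultiplicity_charpoly_map]
  have h0 : ∀ μ ∈ R, μ.re ≠ 0 := by
    have : R.filter (fun μ => μ.re = 0) = 0 := by
      rw [← Multiset.card_eq_zero, ← hA0, eigCount]
    exact Multiset.filter_eq_nil.1 this
  set T := R.filter (fun μ => μ.re < 0) with hT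
  refine ⟨T.toFinset.sup f.maxGenEigenspace, ?_, ?_⟩
  · calc _ ≤ ∑ μ ∈ T.toFinset, finrank ℂ (f.maxGenEigenspace μ) := finrank_finset_sup_le _ _
      _ = ∑ μ ∈ T.toFinset, T.count μ := by
        refine Finset.sum_congr rfl fun μ hμ => ?_
        rw [← hcount, hT, Multiset.count_filter_of_pos]
        exact (Multiset.mem_filter.1 (Multiset.mem_toFinset.1 hμ)).2
      _ = Multiset.card T := Multiset.toFinset_sum_count_eq T
      _ ≤ _ := by
        rw [eigCount]
  · rw [eq_top_iff, ← End.iSup_maxGenEigenspace_eq_top f]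
    refine iSup_le fun μ => ?_
    by_cases hμ : μ ∈ R
    · rcases (h0 μ hμ).lt_or_gt with h | h
      · exact (Finset.le_sup (f := f.maxGenEigenspace)
          (Multiset.mem_toFinset.2
            (Multiset.mem_filter (p := fun μ : ℂ => μ.re < 0).2 ⟨hμ, h⟩))).trans le_sup_right
      · exact (maxGenEigenspace_le_unstableSubspace f h).trans le_sup_left
    · have : finrank ℂ (f.maxGenEigenspace μ) = 0 := by
        rw [← hcount, Multiset.count_eq_zero_of_notMem hμ]
      rw [Submodule.finrank_eq_zero.1 this]
      exact bot_le

theorem eigCount_pos_le_eigCount_neg (A Q P : Matrix (Fin ν) (Fin ν) ℝ)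
    (hA0 : eigCount A (fun μ => μ.re = 0) = 0)
    (hQ : Q.PosSemidef) (hP : P.IsSymm)
    (hLyap : P * A + Aᵀ * P = -Q) :
    eigCount P (fun μ => 0 < μ.re) ≤ eigCount A (fun μ => μ.re < 0) := by
  classical
  have hH : (P.map (algebraMap ℝ ℂ)).IsHermitian := by
    ext i j
    simpa using congrArg (algebraMap ℝ ℂ) (congrFun (congrFun hP i) j)
  obtain ⟨W, hWrank, hW⟩ := hH.exists_posDef_subspace
  obtain ⟨S, hSrank, hS⟩ := exists_sup_unstableSubspace_eq_top A hA0
  set N := unstableSubspace (A.map (algebraMap ℝ ℂ)).toLin'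
  have hLyap' : P.map (algebraMap ℝ ℂ) * A.map (algebraMap ℝ ℂ) +
      (A.map (algebraMap ℝ ℂ))ᴴ * P.map (algebraMap ℝ ℂ) = -Q.map (algebraMap ℝ ℂ) := by
    have hA : (A.map (algebraMap ℝ ℂ))ᴴ = Aᵀ.map (algebraMap ℝ ℂ) := by
      ext i j; simp
    rw [hA, ← Matrix.map_mul, ← Matrix.map_mul, ← Matrix.map_add _ (map_add _), hLyap]
    ext; simp
  have hdisj : Disjoint W N := by
    refine Submodule.disjoint_def.2 fun x hxW hxN => ?_
    by_contra hx
    exact absurd (hW x hxW hx) (not_lt.2 (re_dotProduct_mulVec_nonpos_of_mem_unstableSubspace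
      hQ.re_dotProduct_map_ofReal_nonneg hLyap' hxN))
  have h1 := Submodule.finrank_add_finrank_le_of_disjoint hdisj
  have h2 := Submodule.finrank_add_le_finrank_add_finrank N S
  rw [hS, finrank_top] at h2
  have hPcount : eigCount P (fun μ => 0 < μ.re) = finrank ℂ W := by
    rw [hWrank, eigCount, ← charpoly_map, hH.roots_charpoly_eq_eigenvalues, Multiset.filter_map,
      Multiset.card_map, Fintype.card_subtype]
    simp [Finset.card_def, Function.comp_def]
  omega

end Count

theorem lyapunov_inertia {ν : ℕ} (A Q P : Matrix (Fin ν) (Fin ν) ℝ)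
    (hA0 : eigCount A (fun μ => μ.re = 0) = 0)
    (hQ : Q.PosSemidef) (hP : P.IsSymm)
    (hLyap : P * A + Aᵀ * P = -Q) :
    eigCount P (fun μ => 0 < μ.re) ≤ eigCount A (fun μ => μ.re < 0) ∧
      eigCount P (fun μ => μ.re < 0) ≤ eigCount A (fun μ => 0 < μ.re) := by
  refine ⟨eigCount_pos_le_eigCount_neg A Q P hA0 hQ hP hLyap, ?_⟩
  have h := eigCount_pos_le_eigCount_neg (-A) Q (-P) (by simpa [eigCount_neg] using hA0) hQ hP.neg
    (by simpa using hLyap)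
  simpa [eigCount_neg] using h
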